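/- Let V be a finite vertex set, let k be a positive integer, and let C be a spanning subgraph of a graph G on V such that λ(x,y;C) ≥ min{λ(x,y;G), k} for all vertices x, y ∈ V. Then for every graph H on V, the graph G ∪ H is k-edge connected if and only if the graph C ∪ H is k-edge connected. -/

import Mathlib

/-- The local edge-connectivity `λ(x,y;G)`: the maximum number of pairwise
edge-disjoint paths between `x` and `y` in `G`. -/
noncomputable def localEdgeConn {V : Type*} (G : SimpleGraph V) (x y : V) : ℕ :=
  sSup {n : ℕ | ∃ P : Fin n → G.Path x y, Function.Injective P ∧
    Pairwise fun i j => ∀ e, e ∈ (P i).1.edges → e ∉ (P j).1.edges}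

/-- `G` is `k`-edge connected: the removal of any `k − 1` edges leaves the graph
connected. -/
def IsKEdgeConnected {V : Type*} (G : SimpleGraph V) (k : ℕ) : Prop :=
  ∀ S : Finset (Sym2 V), (S : Set (Sym2 V)) ⊆ G.edgeSet → S.card = k - 1 →
    (G.deleteEdges (S : Set (Sym2 V))).Connected

theorem lec_bdd {V : Type*} [Fintype V] (G : SimpleGraph V) (x y : V) :
    BddAbove {n : ℕ | ∃ P : Fin n → G.Path x y, Function.Injective P ∧
      Pairwise fun i j => ∀ e, e ∈ (P i).1.edges → e ∉ (P j).1.edges} := by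
  classical
  refine ⟨Fintype.card (G.Path x y), ?_⟩
  rintro n ⟨P, hP, -⟩
  simpa using Fintype.card_le_of_injective P hP

theorem lec_mem {V : Type*} [Fintype V] (G : SimpleGraph V) (x y : V) :
    ∃ P : Fin (localEdgeConn G x y) → G.Path x y, Function.Injective P ∧
      Pairwise fun i j => ∀ e, e ∈ (P i).1.edges → e ∉ (P j).1.edges :=
  Nat.sSup_mem (s := {n : ℕ | ∃ P : Fin n → G.Path x y, Function.Injective P ∧
      Pairwise fun i j => ∀ e, e ∈ (P i).1.edges → e ∉ (P j).1.edges})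
    ⟨0, Fin.elim0, fun i => i.elim0, fun i => i.elim0⟩ (lec_bdd G x y)

/-- Adding the edge `xy` increases the local edge-connectivity of `x, y`. -/
theorem lec_succ_le {V : Type*} [Fintype V] {G C : SimpleGraph V} (hCG : C ≤ G) {x y : V}
    (hG : G.Adj x y) (hC : ¬ C.Adj x y) :
    localEdgeConn C x y + 1 ≤ localEdgeConn G x y := by
  obtain ⟨P, hP, hd⟩ := lec_mem C x y
  have hnot : ∀ i, s(x, y) ∉ (P i).1.edges := fun i h =>
    hC ((P i).1.adj_of_mem_edges h)
  refine le_csSup (lec_bdd G x y) ⟨Fin.cons (SimpleGraph.Path.singleton hG)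
    (fun i => ⟨(P i).1.mapLe hCG, (P i).2.mapLe hCG⟩), ?_, ?_⟩
  · rw [Fin.cons_injective_iff]
    constructor
    · rintro ⟨i, hi⟩
      apply hnot i
      have h2 := SimpleGraph.Path.mk'_mem_edges_singleton hG
      rw [← hi] at h2
      simpa using h2
    · intro i j hij
      apply hP
      have h3 : (P i).1.mapLe hCG = (P j).1.mapLe hCG := congrArg Subtype.val hij
      exact Subtype.ext (SimpleGraph.Walk.map_injective_of_injective
        Function.injective_id _ _ h3)
  · have hs : ∀ e, e ∈ (SimpleGraph.Path.singleton hG).1.edges → e = s(x, y) := by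
      intro e he
      simpa [SimpleGraph.Path.singleton] using he
    intro i j hij e
    induction i using Fin.cases with
    | zero =>
      induction j using Fin.cases with
      | zero => exact absurd rfl hij
      | succ j =>
        intro he hj
        have he' := hs e (by simpa using he)
        subst he'
        exact hnot j (by simpa using hj)
    | succ i =>
      induction j using Fin.cases with
      | zero =>
        intro hi he
        have he' := hs e (by simpa using he)
        subst he'
        exact hnot i (by simpa using hi)
      | succ j =>
        have := hd (i := i) (j := j) (by rintro rfl; exact hij rfl) e
        simpa using this

/-- Fewer than `localEdgeConn` edges cannot hit all the paths. -/
theorem exists_avoid {V : Type*} [Fintype V] (C : SimpleGraph V) (x y : V)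
    (S : Finset (Sym2 V)) (hS : S.card < localEdgeConn C x y) :
    ∃ p : C.Walk x y, ∀ e ∈ p.edges, e ∉ S := by
  obtain ⟨P, -, hd⟩ := lec_mem C x y
  by_contra! hcon
  choose f hf hfS using fun i => hcon (P i).1
  have hinj : Function.Injective fun i => (⟨f i, hfS i⟩ : S) := by
    intro i j hij
    have h : f i = f j := congrArg Subtype.val hij
    by_contra hne
    exact hd hne (f i) (hf i) (h ▸ hf j)
  have := Fintype.card_le_of_injective _ hinj
  simp at this
  omega

/-- If `C` is a spanning subgraph of `G` with `λ(x,y;C) ≥ min{λ(x,y;G), k}` for all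
vertices `x, y`, then for every graph `H` on `V`, the graph `G ∪ H` is `k`-edge
connected iff `C ∪ H` is `k`-edge connected. -/
theorem stmt_6 {V : Type*} [Fintype V] (k : ℕ) (hk : 0 < k)
    (G C : SimpleGraph V) (hCG : C ≤ G)
    (hlam : ∀ x y : V, min (localEdgeConn G x y) k ≤ localEdgeConn C x y) :
    ∀ H : SimpleGraph V, IsKEdgeConnected (G ⊔ H) k ↔ IsKEdgeConnected (C ⊔ H) k := by
  classical
  intro H
  have key : ∀ x y, G.Adj x y → ¬ C.Adj x y → k ≤ localEdgeConn C x y := by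
    intro x y hG hC
    have h1 := lec_succ_le hCG hG hC
    have h2 := hlam x y
    rcases min_le_iff.1 h2 with h | h
    · omega
    · exact h
  constructor
  · intro h S hS hc
    have hS' : (S : Set (Sym2 V)) ⊆ (G ⊔ H).edgeSet :=
      hS.trans (SimpleGraph.edgeSet_mono (sup_le_sup_right hCG H))
    have hconn := h S hS' hc
    have hstep : ∀ x y, ((G ⊔ H).deleteEdges (S : Set (Sym2 V))).Adj x y →
        ((C ⊔ H).deleteEdges (S : Set (Sym2 V))).Reachable x y := by
      intro x y hxy
      rw [SimpleGraph.deleteEdges_adj] at hxy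
      by_cases hCH : (C ⊔ H).Adj x y
      · exact SimpleGraph.Adj.reachable (SimpleGraph.deleteEdges_adj.2 ⟨hCH, hxy.2⟩)
      · rw [SimpleGraph.sup_adj, not_or] at hCH
        have hG : G.Adj x y := (SimpleGraph.sup_adj _ _ _ _ |>.1 hxy.1).resolve_right hCH.2
        obtain ⟨p, hp⟩ := exists_avoid C x y S (by have := key x y hG hCH.1; omega)
        exact ⟨(p.mapLe (le_sup_left : C ≤ C ⊔ H)).toDeleteEdges _ (by simpa using hp)⟩
    have := hconn.nonempty
    refine ⟨fun x y => ?_⟩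
    obtain ⟨w⟩ := hconn.preconnected x y
    induction w with
    | nil => exact SimpleGraph.Reachable.refl _
    | cons hadj _ ih => exact (hstep _ _ hadj).trans ih
  · intro h S hS hc
    by_cases hGC : G ≤ C
    · obtain rfl := le_antisymm hCG hGC
      exact h S hS hc
    · have hex : ∃ x y, G.Adj x y ∧ ¬ C.Adj x y := by
        by_contra! hcon
        exact hGC fun x y => hcon x y
      obtain ⟨x, y, hG, hC⟩ := hex
      have hcard : k ≤ C.edgeFinset.card := by
        by_contra! hlt
        obtain ⟨p, hp⟩ := exists_avoid C x y C.edgeFinset (lt_of_lt_of_le hlt (key x y hG hC))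
        cases p with
        | nil => exact hG.ne rfl
        | cons hadj q =>
          exact hp _ (by rw [SimpleGraph.Walk.edges_cons]; exact List.mem_cons_self)
            (by simpa using hadj)
      have hcard2 : C.edgeFinset.card ≤ (C ⊔ H).edgeFinset.card :=
        Finset.card_le_card (SimpleGraph.edgeFinset_mono le_sup_left)
      obtain ⟨T, hT1, hT2, hT3⟩ := Finset.exists_subsuperset_card_eq
        (s := S ∩ (C ⊔ H).edgeFinset) (t := (C ⊔ H).edgeFinset) (n := k - 1)
        Finset.inter_subset_right
        ((Finset.card_le_card Finset.inter_subset_left).trans hc.le) (by omega)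
      have hconn := h T (fun e he => SimpleGraph.mem_edgeFinset.1 (hT2 he)) hT3
      refine hconn.mono ?_
      intro a b hab
      rw [SimpleGraph.deleteEdges_adj] at hab ⊢
      refine ⟨(sup_le_sup_right hCG H) hab.1, fun hs => hab.2 ?_⟩
      exact hT1 (Finset.mem_inter.2 ⟨hs, SimpleGraph.mem_edgeFinset.2 hab.1⟩)
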